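/- arXiv:cond-mat/9712219 — 3 statements merged into one kernel-verified Lean document; each statement's English description precedes it below -/
import Mathlib

section
/- Assume t(x,y) ≥ 0 for all x,y ∈ Λ. Then the smallest eigenvalue of the effective one-hole Hamiltonian H̃ equals the smallest eigenvalue E₀ of the Λ×Λ matrix (−t(x,y))_{x,y∈Λ}, and for each integer n with 0 ≤ n ≤ |Λ| − 1 there exists a nonzero eigenvector of H̃ with eigenvalue E₀ that is supported in the n-th magnetization sector. (This is the weak version of Nagaoka's theorem: at U = ∞ with one hole, among the ground states there are fully polarized ferromagnetic states, one in each magnetization sector.) -/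
/-- A one-hole configuration on the lattice `Λ`: the position `x` of the hole together
with a spin configuration on `Λ ∖ {x}` (`true` = ↑, `false` = ↓). -/
abbrev OneHoleConfig (Λ : Type*) := Σ x : Λ, ({z : Λ // z ≠ x} → Bool)

/-- The spin configuration `σ_{y→x}` on `Λ ∖ {y}` obtained from `σ` (a spin configuration
on `Λ ∖ {x}`) by moving the spin at `y` to `x`; when `y = x` this is `σ` itself. -/
def moveSpin {Λ : Type*} [DecidableEq Λ] (x y : Λ) (σ : {z : Λ // z ≠ x} → Bool) :
    {z : Λ // z ≠ y} → Bool :=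
  fun z => if hzx : (z : Λ) = x then σ ⟨y, fun h => z.prop (hzx.trans h.symm)⟩
           else σ ⟨(z : Λ), hzx⟩

/-- The effective one-hole Hamiltonian `H̃` of the `U = ∞`, `N_e = |Λ| - 1` Hubbard model
with hopping amplitudes `t`: the entry `H̃[(y,τ),(x,σ)]` is `-t x y` if `τ = σ_{y→x}`,
and `0` otherwise. -/
def nagaokaHam {Λ : Type*} [Fintype Λ] [DecidableEq Λ] (t : Λ → Λ → ℝ) :
    Matrix (OneHoleConfig Λ) (OneHoleConfig Λ) ℝ :=
  fun c' c => if c'.2 = moveSpin c.1 c'.1 c.2 then -t c.1 c'.1 else 0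

/-- The number of up spins of a one-hole configuration; the `n`-th magnetization sector
consists of the configurations `c` with `upCount c = n`. -/
def upCount {Λ : Type*} [Fintype Λ] [DecidableEq Λ] (c : OneHoleConfig Λ) : ℕ :=
  (Finset.univ.filter fun z : {z : Λ // z ≠ c.1} => c.2 z = true).card

/-- The bijection of sites that underlies `moveSpin x y`: it sends `x` to `y` and fixes every
other site. -/
def siteEquiv {Λ : Type*} [DecidableEq Λ] (x y : Λ) : {z : Λ // z ≠ y} ≃ {z : Λ // z ≠ x} where
  toFun z := if h : (z : Λ) = x then ⟨y, fun h' => z.prop (h.trans h'.symm)⟩ else ⟨z, h⟩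
  invFun z := if h : (z : Λ) = y then ⟨x, fun h' => z.prop (h.trans h'.symm)⟩ else ⟨z, h⟩
  left_inv := by
    rintro ⟨z, hz⟩
    by_cases h : z = x <;> simp [h, hz]
  right_inv := by
    rintro ⟨z, hz⟩
    by_cases h : z = y <;> simp [h, hz]

lemma moveSpin_eq_comp {Λ : Type*} [DecidableEq Λ] (x y : Λ) (σ : {z : Λ // z ≠ x} → Bool) :
    moveSpin x y σ = σ ∘ siteEquiv x y := by
  funext z
  by_cases h : (z : Λ) = x <;> simp [moveSpin, siteEquiv, h]

lemma siteEquiv_symm {Λ : Type*} [DecidableEq Λ] (x y : Λ) :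
    (siteEquiv x y).symm = siteEquiv y x := rfl

lemma moveSpin_moveSpin {Λ : Type*} [DecidableEq Λ] (x y : Λ) (σ : {z : Λ // z ≠ x} → Bool) :
    moveSpin y x (moveSpin x y σ) = σ := by
  funext z
  simp [moveSpin_eq_comp, ← siteEquiv_symm x y]

/-- Moving the hole from `x` to `y`, as a bijection of spin configurations. -/
def moveSpinEquiv {Λ : Type*} [DecidableEq Λ] (x y : Λ) :
    ({z : Λ // z ≠ x} → Bool) ≃ ({z : Λ // z ≠ y} → Bool) where
  toFun := moveSpin x y
  invFun := moveSpin y x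
  left_inv := moveSpin_moveSpin x y
  right_inv := moveSpin_moveSpin y x

lemma upCount_moveSpin {Λ : Type*} [Fintype Λ] [DecidableEq Λ] (x y : Λ)
    (σ : {z : Λ // z ≠ x} → Bool) : upCount ⟨y, moveSpin x y σ⟩ = upCount ⟨x, σ⟩ :=
  Finset.card_equiv (siteEquiv x y) fun z => by simp [moveSpin_eq_comp]

lemma nagaokaHam_mulVec {Λ : Type*} [Fintype Λ] [DecidableEq Λ] (t : Λ → Λ → ℝ)
    (Φ : OneHoleConfig Λ → ℝ) (y : Λ) (τ : {z : Λ // z ≠ y} → Bool) :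
    (nagaokaHam t).mulVec Φ ⟨y, τ⟩ = ∑ x, -t x y * Φ ⟨x, moveSpin y x τ⟩ := by
  simp only [Matrix.mulVec, dotProduct, Fintype.sum_sigma]
  refine Finset.sum_congr rfl fun x _ => ?_
  rw [Finset.sum_eq_single (moveSpin y x τ)]
  · simp [nagaokaHam, moveSpin_moveSpin]
  · intro σ _ hσ
    have hτ : τ ≠ moveSpin x y σ := by
      rintro rfl
      exact hσ (moveSpin_moveSpin x y σ).symm
    simp [nagaokaHam, hτ]
  · simp

lemma exists_upCount_eq {Λ : Type*} [Fintype Λ] [DecidableEq Λ] (x : Λ) {n : ℕ}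
    (hn : n ≤ Fintype.card Λ - 1) : ∃ σ, upCount (⟨x, σ⟩ : OneHoleConfig Λ) = n := by
  have hcard : n ≤ (Finset.univ : Finset {z : Λ // z ≠ x}).card := by
    simpa [Fintype.card_subtype_compl] using hn
  obtain ⟨s, -, hs⟩ := Finset.exists_subset_card_eq hcard
  exact ⟨fun z => decide (z ∈ s), by simpa [upCount] using hs⟩

/-- The quadratic form of a real symmetric matrix is bounded below by any lower bound of its
eigenvalues. -/
lemma Matrix.IsHermitian.mul_dotProduct_le {ι : Type*} [Fintype ι] [DecidableEq ι]
    {A : Matrix ι ι ℝ} (hA : A.IsHermitian) {m : ℝ}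
    (hm : m ∈ lowerBounds {μ : ℝ | ∃ ξ : ι → ℝ, ξ ≠ 0 ∧ A.mulVec ξ = μ • ξ}) (v : ι → ℝ) :
    m * (v ⬝ᵥ v) ≤ v ⬝ᵥ A.mulVec v := by
  have hB : (A - m • (1 : Matrix ι ι ℝ)).IsHermitian := by
    refine hA.sub ?_
    simp [Matrix.IsHermitian]
  have hpsd : (A - m • (1 : Matrix ι ι ℝ)).PosSemidef := by
    rw [hB.posSemidef_iff_eigenvalues_nonneg]
    intro i
    have hle : m ≤ hB.eigenvalues i + m := by
      refine hm ⟨(hB.eigenvectorBasis i).ofLp, ?_, ?_⟩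
      · simpa using hB.eigenvectorBasis.orthonormal.ne_zero i
      · have h := hB.mulVec_eigenvectorBasis i
        rw [Matrix.sub_mulVec, Matrix.smul_mulVec, Matrix.one_mulVec, sub_eq_iff_eq_add] at h
        rw [h, add_smul]
    simpa using hle
  have h := hpsd.dotProduct_mulVec_nonneg v
  rw [Matrix.sub_mulVec, Matrix.smul_mulVec, Matrix.one_mulVec, dotProduct_sub,
    dotProduct_smul, smul_eq_mul, star_trivial] at h
  linarith

/-- **Weak version of Nagaoka's theorem** (Theorem 4.1). If `t x y ≥ 0` for all `x, y`,
then the smallest eigenvalue of the effective one-hole Hamiltonian `H̃` equals the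
smallest eigenvalue `E₀` of the matrix `(-t x y)`, and in each magnetization sector
(`n ≤ |Λ| - 1`) there is a nonzero eigenvector of `H̃` with eigenvalue `E₀` supported
in that sector. -/
theorem nagaoka_weak
    {Λ : Type*} [Fintype Λ] [DecidableEq Λ] (t : Λ → Λ → ℝ)
    (hsym : ∀ x y, t x y = t y x) (hpos : ∀ x y, 0 ≤ t x y) (E₀ : ℝ)
    (hE₀ : IsLeast {μ : ℝ |
      ∃ ξ : Λ → ℝ, ξ ≠ 0 ∧ (Matrix.of fun x y : Λ => -t x y).mulVec ξ = μ • ξ} E₀) :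
    IsLeast {μ : ℝ | ∃ Φ : OneHoleConfig Λ → ℝ, Φ ≠ 0 ∧
        (nagaokaHam t).mulVec Φ = μ • Φ} E₀ ∧
    ∀ n : ℕ, n ≤ Fintype.card Λ - 1 →
      ∃ Φ : OneHoleConfig Λ → ℝ, Φ ≠ 0 ∧ (∀ c, upCount c ≠ n → Φ c = 0) ∧
        (nagaokaHam t).mulVec Φ = E₀ • Φ := by
  have hsector : ∀ n : ℕ, n ≤ Fintype.card Λ - 1 →
      ∃ Φ : OneHoleConfig Λ → ℝ, Φ ≠ 0 ∧ (∀ c, upCount c ≠ n → Φ c = 0) ∧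
        (nagaokaHam t).mulVec Φ = E₀ • Φ := by
    intro n hn
    obtain ⟨ξ, hξ, hev⟩ := hE₀.1
    refine ⟨fun c => if upCount c = n then ξ c.1 else 0, ?_, fun c hc => if_neg hc, ?_⟩
    · obtain ⟨x, hx⟩ := Function.ne_iff.mp hξ
      obtain ⟨σ, hσ⟩ := exists_upCount_eq x hn
      exact Function.ne_iff.mpr ⟨⟨x, σ⟩, by simpa [hσ] using hx⟩
    · funext ⟨y, τ⟩
      rw [nagaokaHam_mulVec]
      simp only [upCount_moveSpin, Pi.smul_apply, smul_eq_mul]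
      split_ifs
      · simpa [Matrix.mulVec, dotProduct, hsym] using congrFun hev y
      · simp
  refine ⟨⟨?_, ?_⟩, hsector⟩
  · obtain ⟨Φ, hΦ, -, hev⟩ := hsector 0 (Nat.zero_le _)
    exact ⟨Φ, hΦ, hev⟩
  · rintro μ ⟨Φ, hΦ, hev⟩
    have hA : (Matrix.of fun x y : Λ => -t x y).IsHermitian := by
      ext x y
      simp [hsym y x]
    set ξ : Λ → ℝ := fun x => √(∑ σ, Φ ⟨x, σ⟩ ^ 2) with hξ
    have hnorm : ξ ⬝ᵥ ξ = Φ ⬝ᵥ Φ := by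
      simp only [dotProduct, Fintype.sum_sigma, hξ, ← sq]
      exact Finset.sum_congr rfl fun x _ =>
        Real.sq_sqrt (Finset.sum_nonneg fun σ _ => sq_nonneg _)
    have hcs (x y : Λ) : ∑ τ, Φ ⟨y, τ⟩ * Φ ⟨x, moveSpin y x τ⟩ ≤ ξ y * ξ x := by
      refine (Real.sum_mul_le_sqrt_mul_sqrt _ _ _).trans_eq ?_
      exact congrArg (fun r => ξ y * √r)
        ((moveSpinEquiv y x).sum_comp fun σ => Φ ⟨x, σ⟩ ^ 2)
    have hform : ξ ⬝ᵥ (Matrix.of fun x y : Λ => -t x y).mulVec ξ ≤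
        Φ ⬝ᵥ (nagaokaHam t).mulVec Φ := by
      simp only [dotProduct, Fintype.sum_sigma, nagaokaHam_mulVec]
      refine Finset.sum_le_sum fun y _ => ?_
      simp only [Matrix.mulVec, dotProduct, Matrix.of_apply, Finset.mul_sum]
      rw [Finset.sum_comm]
      refine Finset.sum_le_sum fun x _ => ?_
      have h := mul_le_mul_of_nonneg_left (hcs x y) (hpos x y)
      rw [Finset.mul_sum] at h
      calc ξ y * (-t y x * ξ x) = -(t x y * (ξ y * ξ x)) := by rw [hsym y x]; ring
        _ ≤ -∑ τ, t x y * (Φ ⟨y, τ⟩ * Φ ⟨x, moveSpin y x τ⟩) := neg_le_neg h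
        _ = ∑ τ, Φ ⟨y, τ⟩ * (-t x y * Φ ⟨x, moveSpin y x τ⟩) := by
          rw [← Finset.sum_neg_distrib]
          exact Finset.sum_congr rfl fun τ _ => by ring
    have hbound := (hA.mul_dotProduct_le hE₀.2 ξ).trans hform
    rw [hev, dotProduct_smul, smul_eq_mul, hnorm] at hbound
    have hΦpos : 0 < Φ ⬝ᵥ Φ :=
      lt_of_le_of_ne (Finset.sum_nonneg fun c _ => mul_self_nonneg _)
        (Ne.symm (mt dotProduct_self_eq_zero.mp hΦ))
    exact le_of_mul_le_mul_right hbound hΦpos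
end

section
/- Let t > 0, s > 0, λ > 0 be real numbers and k ∈ ℝ. The eigenvalues of the real symmetric 2×2 matrix B(k) = [[2t·cos k, 2λ(t+s)·cos(k/2)], [2λ(t+s)·cos(k/2), (λ² − 2)(t+s) − 2s·cos k]] are exactly ε_1(k) = −2(t+s) − 2s·cos k and ε_2(k) = λ²(t+s) + 2t·cos k, and ε_1(k) < ε_2(k) for every k. -/
/-- A scalar is an eigenvalue of a square matrix over a field iff it is a root of the
characteristic determinant. -/
theorem Matrix.exists_mulVec_eq_smul_iff_det_sub_eq_zero {n K : Type*} [Fintype n]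
    [DecidableEq n] [Field K] (A : Matrix n n K) (μ : K) :
    (∃ v : n → K, v ≠ 0 ∧ A.mulVec v = μ • v) ↔ (A - Matrix.scalar n μ).det = 0 := by
  rw [← Matrix.exists_mulVec_eq_zero_iff]
  simp [Matrix.sub_mulVec, sub_eq_zero, ← Matrix.smul_one_eq_diagonal, Matrix.smul_mulVec]

/-- Dispersion relations of the one-dimensional nearly-flat-band model of Section 6.7:
for `t, s, λ > 0`, the eigenvalues of the Bloch Hamiltonian
`B(k) = [[2t cos k, 2λ(t+s) cos(k/2)], [2λ(t+s) cos(k/2), (λ² - 2)(t+s) - 2s cos k]]`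
are exactly `ε₁(k) = -2(t+s) - 2s cos k` and `ε₂(k) = λ²(t+s) + 2t cos k`, with
`ε₁(k) < ε₂(k)` for every `k`. -/
theorem nearlyFlatBandChain_eigenvalues (t s lam : ℝ)
    (ht : 0 < t) (hs : 0 < s) (hlam : 0 < lam) (k : ℝ) :
    (∀ μ : ℝ,
      (∃ v : Fin 2 → ℝ, v ≠ 0 ∧
        (!![2 * t * Real.cos k, 2 * lam * (t + s) * Real.cos (k / 2);
            2 * lam * (t + s) * Real.cos (k / 2),
            (lam ^ 2 - 2) * (t + s) - 2 * s * Real.cos k]).mulVec v = μ • v) ↔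
      (μ = -(2 * (t + s)) - 2 * s * Real.cos k ∨
       μ = lam ^ 2 * (t + s) + 2 * t * Real.cos k)) ∧
    -(2 * (t + s)) - 2 * s * Real.cos k < lam ^ 2 * (t + s) + 2 * t * Real.cos k := by
  have hcos : Real.cos k = 2 * Real.cos (k / 2) ^ 2 - 1 := by
    rw [← Real.cos_two_mul, mul_div_cancel₀ k two_ne_zero]
  refine ⟨fun μ => ?_, ?_⟩
  · rw [Matrix.exists_mulVec_eq_smul_iff_det_sub_eq_zero, Matrix.det_fin_two,
      ← sub_eq_zero (a := μ), ← sub_eq_zero (a := μ) (b := lam ^ 2 * _ + _), ← mul_eq_zero]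
    simp only [Matrix.sub_apply, Matrix.scalar_apply, Matrix.diagonal_apply, Matrix.of_apply,
      Matrix.cons_val', Matrix.cons_val_zero, Matrix.cons_val_one, Matrix.cons_val_fin_one,
      if_true, zero_ne_one, one_ne_zero, if_false, hcos]
    ring_nf
  · have hpos : 0 < (t + s) * (lam ^ 2 + 2 * (1 + Real.cos k)) := by
      have := Real.neg_one_le_cos k
      have : 0 ≤ 1 + Real.cos k := by linarith
      positivity
    linarith
end

section
/- Let N_s ≥ 4 be even, let N_e be odd with 1 ≤ N_e < N_s, and let t > 0 and t' > 0. For each n ∈ {0,...,N_e}, the restriction of the U = ∞ correlated-hopping Hamiltonian M to the n-th magnetization sector has a simple smallest eigenvalue E_n (its lowest eigenspace is one-dimensional), and these values coincide: E_0 = E_1 = ... = E_{N_e}. In particular the ground-state eigenspace of M has dimension exactly N_e + 1, with exactly one ground state in each magnetization sector. (This is Theorem 7.2: the ground states of the Hubbard chain with correlated next-nearest-neighbour hopping at U = ∞ have total spin S_max = N_e/2 and are nondegenerate apart from the trivial (2S_max+1)-fold degeneracy.) -/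
/-- A configuration of the chain `ℤ/N_sℤ`: each site is empty (`none`), or carries an
up spin (`some true`) or a down spin (`some false`). -/
abbrev ChainCfg (Ns : ℕ) := ZMod Ns → Option Bool

/-- The number of occupied sites of a configuration. -/
def occNum {Ns : ℕ} [NeZero Ns] (ω : ChainCfg Ns) : ℕ :=
  (Finset.univ.filter fun x : ZMod Ns => ω x ≠ none).card

/-- The number of up spins of a configuration. -/
def upNum {Ns : ℕ} [NeZero Ns] (ω : ChainCfg Ns) : ℕ :=
  (Finset.univ.filter fun x : ZMod Ns => ω x = some true).card

/-- `ω'` is obtained from `ω` by moving the spin at some site to an empty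
cyclically-nearest-neighbour site. -/
def NNHop {Ns : ℕ} (ω ω' : ChainCfg Ns) : Prop :=
  ∃ x : ZMod Ns,
    (ω x ≠ none ∧ ω (x + 1) = none ∧
      ω' = Function.update (Function.update ω x none) (x + 1) (ω x)) ∨
    (ω (x + 1) ≠ none ∧ ω x = none ∧
      ω' = Function.update (Function.update ω (x + 1) none) x (ω (x + 1)))

/-- `ω'` is obtained from `ω` by moving the spin at an even site `2j` to the empty even
site `2j + 2` (or back), under the condition that the intermediate site `2j + 1` is
occupied. -/
def CorrelatedHop {Ns : ℕ} [NeZero Ns] (ω ω' : ChainCfg Ns) : Prop :=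
  ∃ x : ZMod Ns, x.val % 2 = 0 ∧ ω (x + 1) ≠ none ∧
    ((ω x ≠ none ∧ ω (x + 2) = none ∧
      ω' = Function.update (Function.update ω x none) (x + 2) (ω x)) ∨
     (ω (x + 2) ≠ none ∧ ω x = none ∧
      ω' = Function.update (Function.update ω (x + 2) none) x (ω (x + 2))))

/-- Hard-core configurations with exactly `Ne` electrons. -/
abbrev HardCoreCfg (Ns Ne : ℕ) [NeZero Ns] := {ω : ChainCfg Ns // occNum ω = Ne}

open Classical in
/-- The `U = ∞` correlated-hopping Hamiltonian of Section 7.3 (Hamiltonian (7.4) in the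
limit `U → ∞`), written in the ordered position–spin basis of the no-double-occupancy
subspace: entry `-t` for nearest-neighbour hops, `-t'` for next-nearest-neighbour hops
between even sites through an occupied intermediate site (the sign incorporating the
fermionic exchange), and all other entries `0`. -/
noncomputable def corrHopHam (Ns Ne : ℕ) [NeZero Ns] (t t' : ℝ) :
    Matrix (HardCoreCfg Ns Ne) (HardCoreCfg Ns Ne) ℝ :=
  fun ω' ω =>
    if NNHop ω.1 ω'.1 then -t
    else if CorrelatedHop ω.1 ω'.1 then -t'
    else 0

section PerronFrobenius

open Matrix

variable {ι : Type*} [Fintype ι]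

/-- A real symmetric matrix has a unit vector minimizing its quadratic form. -/
lemma exists_forall_mul_dotProduct_le [Nonempty ι] (A : Matrix ι ι ℝ) :
    ∃ (E : ℝ) (x : ι → ℝ), x ≠ 0 ∧ x ⬝ᵥ A *ᵥ x = E * (x ⬝ᵥ x) ∧
      ∀ y : ι → ℝ, E * (y ⬝ᵥ y) ≤ y ⬝ᵥ A *ᵥ y := by
  classical
  have hcont : Continuous fun x : ι → ℝ => x ⬝ᵥ A *ᵥ x := by fun_prop
  have hcomp : IsCompact {x : ι → ℝ | x ⬝ᵥ x = 1} := by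
    refine Metric.isCompact_of_isClosed_isBounded ?_ ?_
    · exact isClosed_eq (by fun_prop) continuous_const
    · refine (Metric.isBounded_closedBall (x := (0 : ι → ℝ)) (r := 1)).subset fun x hx => ?_
      rw [mem_closedBall_zero_iff, pi_norm_le_iff_of_nonneg zero_le_one]
      intro i
      have h1 : x i * x i ≤ x ⬝ᵥ x :=
        Finset.single_le_sum (f := fun i => x i * x i) (fun j _ => mul_self_nonneg (x j))
          (Finset.mem_univ i)
      rw [show x ⬝ᵥ x = 1 from hx] at h1
      rw [Real.norm_eq_abs]
      exact abs_le_one_iff_mul_self_le_one.mpr h1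
  obtain ⟨i₀⟩ := ‹Nonempty ι›
  obtain ⟨x, hx, hmin⟩ := hcomp.exists_isMinOn ⟨Pi.single i₀ 1, by simp⟩ hcont.continuousOn
  have hx1 : x ⬝ᵥ x = 1 := hx
  refine ⟨x ⬝ᵥ A *ᵥ x, x, ?_, by rw [hx1, mul_one], fun y => ?_⟩
  · rintro rfl
    simp at hx1
  · rcases eq_or_ne y 0 with rfl | hy
    · simp
    have hpos : 0 < y ⬝ᵥ y :=
      lt_of_le_of_ne (Finset.sum_nonneg fun i _ => mul_self_nonneg (y i))
        fun h => hy (dotProduct_self_eq_zero.mp h.symm)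
    set r := Real.sqrt (y ⬝ᵥ y) with hr
    have hr0 : 0 < r := Real.sqrt_pos.mpr hpos
    have hrr : r * r = y ⬝ᵥ y := Real.mul_self_sqrt hpos.le
    have hmem : (r⁻¹ • y) ⬝ᵥ (r⁻¹ • y) = 1 := by
      rw [smul_dotProduct, dotProduct_smul, smul_eq_mul, smul_eq_mul, ← hrr]
      field_simp
    have h2 : x ⬝ᵥ A *ᵥ x ≤ (r⁻¹ • y) ⬝ᵥ A *ᵥ (r⁻¹ • y) := hmin hmem
    rw [mulVec_smul, smul_dotProduct, dotProduct_smul, smul_eq_mul, smul_eq_mul] at h2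
    calc (x ⬝ᵥ A *ᵥ x) * (y ⬝ᵥ y)
        ≤ (r⁻¹ * (r⁻¹ * (y ⬝ᵥ A *ᵥ y))) * (y ⬝ᵥ y) := mul_le_mul_of_nonneg_right h2 hpos.le
      _ = y ⬝ᵥ A *ᵥ y := by
          rw [← hrr]
          field_simp

/-- Perron–Frobenius: a symmetric irreducible matrix with nonpositive entries has a
strictly positive eigenvector. -/
lemma exists_pos_eigenvector [Nonempty ι] {A : Matrix ι ι ℝ} (hsymm : Aᵀ = A)
    (hA : ∀ i j, A i j ≤ 0)
    (hirr : ∀ p : ι → Prop, (∀ i j, p i → A i j ≠ 0 → p j) → (∃ i, p i) → ∀ i, p i) :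
    ∃ (E : ℝ) (ψ : ι → ℝ), (∀ i, 0 < ψ i) ∧ A *ᵥ ψ = E • ψ := by
  classical
  obtain ⟨E, x, hx0, hxE, hE⟩ := exists_forall_mul_dotProduct_le A
  have habs : |x| ⬝ᵥ |x| = x ⬝ᵥ x := by simp [dotProduct]
  have hle : |x| ⬝ᵥ A *ᵥ |x| ≤ x ⬝ᵥ A *ᵥ x := by
    simp only [dotProduct, mulVec, Finset.mul_sum, Pi.abs_apply]
    refine Finset.sum_le_sum fun i _ => Finset.sum_le_sum fun j _ => ?_
    have h1 : x i * x j ≤ |x i| * |x j| := (le_abs_self _).trans (abs_mul _ _).le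
    nlinarith [hA i j]
  have hpsd : (A - E • (1 : Matrix ι ι ℝ)).PosSemidef := by
    refine PosSemidef.of_dotProduct_mulVec_nonneg ?_ fun y => ?_
    · rw [IsHermitian, conjTranspose_eq_transpose_of_trivial, transpose_sub, transpose_smul,
        transpose_one, hsymm]
    · have := hE y
      simp only [sub_mulVec, smul_mulVec, one_mulVec, dotProduct_sub, dotProduct_smul,
        star_trivial, smul_eq_mul]
      linarith
  have heig : A *ᵥ |x| = E • |x| := by
    have h1 := (hpsd.dotProduct_mulVec_zero_iff |x|).mp (by
      have := hE |x|
      simp only [sub_mulVec, smul_mulVec, one_mulVec, dotProduct_sub, dotProduct_smul,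
        star_trivial, smul_eq_mul]
      rw [habs] at this ⊢
      linarith)
    rwa [sub_mulVec, smul_mulVec, one_mulVec, sub_eq_zero] at h1
  refine ⟨E, |x|, ?_, heig⟩
  by_contra! hneg
  obtain ⟨k, hk⟩ := hneg
  have hk0 : x k = 0 := abs_nonpos_iff.mp hk
  refine hx0 (funext (hirr (fun i => x i = 0) (fun i j hi hij => ?_) ⟨k, hk0⟩))
  have h1 : ∑ j, A i j * |x j| = 0 := by
    have := congrFun heig i
    simpa [mulVec, dotProduct, hi] using this
  have h2 := (Finset.sum_eq_zero_iff_of_nonpos fun j _ =>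
    mul_nonpos_of_nonpos_of_nonneg (hA i j) (abs_nonneg (x j))).mp h1 j (Finset.mem_univ j)
  simpa [hij] using h2

/-- The ground-state representation of a symmetric matrix with a nowhere vanishing
eigenvector `ψ`. -/
lemma sum_mul_sq_sub_eq {A : Matrix ι ι ℝ} (hsymm : Aᵀ = A) {E μ : ℝ} {ψ Φ : ι → ℝ}
    (hψ : ∀ i, 0 < ψ i) (hE : A *ᵥ ψ = E • ψ) (hμ : A *ᵥ Φ = μ • Φ) :
    ∑ i, ∑ j, -A i j * (ψ i * ψ j) * (Φ i / ψ i - Φ j / ψ j) ^ 2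
      = 2 * (μ - E) * ∑ i, Φ i ^ 2 := by
  have hEi (i) : ∑ j, A i j * ψ j = E * ψ i := by simpa [mulVec, dotProduct] using congrFun hE i
  have hμi (i) : ∑ j, A i j * Φ j = μ * Φ i := by simpa [mulVec, dotProduct] using congrFun hμ i
  have hA (i j) : A i j = A j i := congrFun (congrFun hsymm j) i |>.symm ▸ rfl
  have h1 : ∑ i, ∑ j, A i j * ψ j * (Φ i ^ 2 / ψ i) = E * ∑ i, Φ i ^ 2 := by
    rw [Finset.mul_sum]
    refine Finset.sum_congr rfl fun i _ => ?_
    rw [← Finset.sum_mul, hEi]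
    have := (hψ i).ne'
    field_simp
  have h2 : ∑ i, ∑ j, A i j * ψ i * (Φ j ^ 2 / ψ j) = E * ∑ i, Φ i ^ 2 := by
    rw [Finset.sum_comm, ← h1]
    exact Finset.sum_congr rfl fun i _ => Finset.sum_congr rfl fun j _ => by rw [hA]
  have h3 : ∑ i, ∑ j, A i j * Φ j * Φ i = μ * ∑ i, Φ i ^ 2 := by
    rw [Finset.mul_sum]
    refine Finset.sum_congr rfl fun i _ => ?_
    rw [← Finset.sum_mul, hμi]
    ring
  calc ∑ i, ∑ j, -A i j * (ψ i * ψ j) * (Φ i / ψ i - Φ j / ψ j) ^ 2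
      = ∑ i, ∑ j, (2 * (A i j * Φ j * Φ i) - A i j * ψ j * (Φ i ^ 2 / ψ i)
          - A i j * ψ i * (Φ j ^ 2 / ψ j)) := by
        refine Finset.sum_congr rfl fun i _ => Finset.sum_congr rfl fun j _ => ?_
        have hi := (hψ i).ne'
        have hj := (hψ j).ne'
        field_simp
        ring
    _ = 2 * (μ - E) * ∑ i, Φ i ^ 2 := by
        simp only [Finset.sum_sub_distrib, ← Finset.mul_sum]
        rw [h1, h2, h3]
        ring

/-- The eigenvalue of a positive eigenvector is the smallest one. -/
lemma le_eigenvalue_of_pos_eigenvector {A : Matrix ι ι ℝ} (hsymm : Aᵀ = A)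
    (hA : ∀ i j, A i j ≤ 0) {E μ : ℝ} {ψ Φ : ι → ℝ} (hψ : ∀ i, 0 < ψ i)
    (hE : A *ᵥ ψ = E • ψ) (hμ : A *ᵥ Φ = μ • Φ) (hΦ : Φ ≠ 0) : E ≤ μ := by
  have h := sum_mul_sq_sub_eq hsymm hψ hE hμ
  have h0 : 0 ≤ ∑ i, ∑ j, -A i j * (ψ i * ψ j) * (Φ i / ψ i - Φ j / ψ j) ^ 2 :=
    Finset.sum_nonneg fun i _ => Finset.sum_nonneg fun j _ =>
      mul_nonneg (mul_nonneg (neg_nonneg.mpr (hA i j)) (mul_pos (hψ i) (hψ j)).le) (sq_nonneg _)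
  obtain ⟨k, hk⟩ := Function.ne_iff.mp hΦ
  have hpos : 0 < ∑ i, Φ i ^ 2 :=
    Finset.sum_pos' (fun i _ => sq_nonneg _)
      ⟨k, Finset.mem_univ k, by positivity [show Φ k ≠ 0 from hk]⟩
  nlinarith

/-- An eigenvector for the eigenvalue of a positive eigenvector `ψ` is proportional to `ψ`
along nonzero matrix entries. -/
lemma div_eq_div_of_pos_eigenvector {A : Matrix ι ι ℝ} (hsymm : Aᵀ = A)
    (hA : ∀ i j, A i j ≤ 0) {E : ℝ} {ψ Φ : ι → ℝ} (hψ : ∀ i, 0 < ψ i)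
    (hE : A *ᵥ ψ = E • ψ) (hΦ : A *ᵥ Φ = E • Φ) {i j : ι} (hij : A i j ≠ 0) :
    Φ i / ψ i = Φ j / ψ j := by
  have h := sum_mul_sq_sub_eq hsymm hψ hE hΦ
  rw [sub_self, mul_zero, zero_mul] at h
  have hnn (i j) : 0 ≤ -A i j * (ψ i * ψ j) * (Φ i / ψ i - Φ j / ψ j) ^ 2 :=
    mul_nonneg (mul_nonneg (neg_nonneg.mpr (hA i j)) (mul_pos (hψ i) (hψ j)).le) (sq_nonneg _)
  have h1 := (Finset.sum_eq_zero_iff_of_nonneg fun i _ =>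
    Finset.sum_nonneg fun j _ => hnn i j).mp h i (Finset.mem_univ i)
  have h2 := (Finset.sum_eq_zero_iff_of_nonneg fun j _ => hnn i j).mp h1 j (Finset.mem_univ j)
  simpa [hij, (hψ i).ne', (hψ j).ne', sub_eq_zero] using h2

end PerronFrobenius

section Chain

open Equiv

variable {Ns : ℕ}

/-- Cyclic nearest neighbours. -/
def NNAdj (x y : ZMod Ns) : Prop := y = x + 1 ∨ x = y + 1

/-- Next-nearest even neighbours whose intermediate site is occupied in `ω`. -/
def CorrAdj (ω : ChainCfg Ns) (x y : ZMod Ns) : Prop :=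
  ∃ z : ZMod Ns, z.val % 2 = 0 ∧ ω (z + 1) ≠ none ∧
    ((x = z ∧ y = z + 2) ∨ (x = z + 2 ∧ y = z))

lemma comp_swap_eq_of_hole {ω : ChainCfg Ns} {x y : ZMod Ns} (hx : ω x ≠ none)
    (hy : ω y = none) :
    ω ∘ swap x y = Function.update (Function.update ω x none) y (ω x) := by
  have hxy : x ≠ y := by rintro rfl; exact hx hy
  rw [Equiv.comp_swap_eq_update, hy, Function.update_comm hxy.symm]

lemma nnHop_iff {ω ω' : ChainCfg Ns} :
    NNHop ω ω' ↔ ∃ x y, NNAdj x y ∧ ω x ≠ none ∧ ω y = none ∧ ω' = ω ∘ swap x y := by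
  constructor
  · rintro ⟨x, ⟨h1, h2, h3⟩ | ⟨h1, h2, h3⟩⟩
    · exact ⟨x, x + 1, Or.inl rfl, h1, h2, by rw [h3, comp_swap_eq_of_hole h1 h2]⟩
    · exact ⟨x + 1, x, Or.inr rfl, h1, h2, by rw [h3, comp_swap_eq_of_hole h1 h2]⟩
  · rintro ⟨x, y, rfl | rfl, h1, h2, h3⟩
    · exact ⟨x, Or.inl ⟨h1, h2, by rw [h3, comp_swap_eq_of_hole h1 h2]⟩⟩
    · exact ⟨y, Or.inr ⟨h1, h2, by rw [h3, comp_swap_eq_of_hole h1 h2]⟩⟩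

lemma correlatedHop_iff [NeZero Ns] {ω ω' : ChainCfg Ns} :
    CorrelatedHop ω ω' ↔
      ∃ x y, CorrAdj ω x y ∧ ω x ≠ none ∧ ω y = none ∧ ω' = ω ∘ swap x y := by
  constructor
  · rintro ⟨x, hx, hm, ⟨h1, h2, h3⟩ | ⟨h1, h2, h3⟩⟩
    · exact ⟨x, x + 2, ⟨x, hx, hm, Or.inl ⟨rfl, rfl⟩⟩, h1, h2, by
        rw [h3, comp_swap_eq_of_hole h1 h2]⟩
    · exact ⟨x + 2, x, ⟨x, hx, hm, Or.inr ⟨rfl, rfl⟩⟩, h1, h2, by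
        rw [h3, comp_swap_eq_of_hole h1 h2]⟩
  · rintro ⟨x, y, ⟨z, hz, hm, ⟨rfl, rfl⟩ | ⟨rfl, rfl⟩⟩, h1, h2, h3⟩
    · exact ⟨x, hz, hm, Or.inl ⟨h1, h2, by rw [h3, comp_swap_eq_of_hole h1 h2]⟩⟩
    · exact ⟨y, hz, hm, Or.inr ⟨h1, h2, by rw [h3, comp_swap_eq_of_hole h1 h2]⟩⟩

/-- The two sites involved in a hop are determined by the occupied sites before and after. -/
lemma eq_of_comp_swap_eq_none_iff {ω : ChainCfg Ns} {x y x' y' : ZMod Ns} (hx : ω x ≠ none)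
    (hy : ω y = none) (hx' : ω x' ≠ none) (hy' : ω y' = none)
    (h : ω ∘ swap x y = ω ∘ swap x' y') : x = x' ∧ y = y' := by
  constructor
  · by_contra hne
    have h1 := congrFun h x
    have hxy' : x ≠ y' := by rintro rfl; exact hx hy'
    simp only [Function.comp_apply, swap_apply_left, swap_apply_of_ne_of_ne hne hxy'] at h1
    exact hx (h1 ▸ hy)
  · by_contra hne
    have h1 := congrFun h y
    have hyx' : y ≠ x' := by rintro rfl; exact hx' hy
    simp only [Function.comp_apply, swap_apply_right, swap_apply_of_ne_of_ne hyx' hne] at h1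
    exact hx (h1 ▸ hy)

lemma nnHop_comp_swap_iff {ω : ChainCfg Ns} {x y : ZMod Ns} (hx : ω x ≠ none)
    (hy : ω y = none) : NNHop ω (ω ∘ swap x y) ↔ NNAdj x y := by
  rw [nnHop_iff]
  constructor
  · rintro ⟨x', y', h, hx', hy', he⟩
    obtain ⟨rfl, rfl⟩ := eq_of_comp_swap_eq_none_iff hx hy hx' hy' he
    exact h
  · exact fun h => ⟨x, y, h, hx, hy, rfl⟩

lemma NNHop.symm {ω ω' : ChainCfg Ns} (h : NNHop ω ω') : NNHop ω' ω := by
  obtain ⟨x, y, hxy, hx, hy, rfl⟩ := nnHop_iff.mp h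
  refine nnHop_iff.mpr ⟨y, x, Or.symm hxy, by simpa using hx, by simpa using hy, ?_⟩
  rw [Function.comp_assoc, swap_comm y x, ← Equiv.Perm.coe_mul, Equiv.swap_mul_self]
  rfl

/-- The configuration with every spin turned up. -/
def allUp (ω : ChainCfg Ns) : ChainCfg Ns := fun x => (ω x).map fun _ => true

@[simp] lemma allUp_eq_none_iff {ω : ChainCfg Ns} {x : ZMod Ns} :
    allUp ω x = none ↔ ω x = none := by
  simp [allUp]

lemma allUp_comp (ω : ChainCfg Ns) (f : ZMod Ns → ZMod Ns) : allUp (ω ∘ f) = allUp ω ∘ f := rfl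

lemma corrAdj_allUp {ω : ChainCfg Ns} {x y : ZMod Ns} :
    CorrAdj (allUp ω) x y ↔ CorrAdj ω x y := by
  simp [CorrAdj]

lemma corrAdj_symm {ω : ChainCfg Ns} {x y : ZMod Ns} (h : CorrAdj ω x y) : CorrAdj ω y x := by
  obtain ⟨z, hz, hm, h | h⟩ := h
  · exact ⟨z, hz, hm, Or.inr h.symm⟩
  · exact ⟨z, hz, hm, Or.inl h.symm⟩

lemma zmod_zero_one_two_distinct (hNs : 4 ≤ Ns) :
    (0 : ZMod Ns) ≠ 1 ∧ (2 : ZMod Ns) ≠ 1 ∧ (0 : ZMod Ns) ≠ 2 := by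
  have h01 : (0 : ZMod Ns) ≠ 1 := by
    have : Fact (1 < Ns) := ⟨by omega⟩
    exact zero_ne_one
  have h21 : (2 : ZMod Ns) ≠ 1 := fun h => h01 (by linear_combination -h)
  have h02 : (0 : ZMod Ns) ≠ 2 := by
    intro h
    have := congrArg ZMod.val h
    rw [ZMod.val_zero, show (2 : ZMod Ns) = ((2 : ℕ) : ZMod Ns) by norm_num,
      ZMod.val_cast_of_lt (by omega)] at this
    omega
  exact ⟨h01, h21, h02⟩

variable [NeZero Ns]

lemma card_filter_comp_perm (ω : ChainCfg Ns) (σ : Perm (ZMod Ns)) (p : Option Bool → Prop)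
    [DecidablePred p] :
    (Finset.univ.filter fun x => p ((ω ∘ σ) x)).card
      = (Finset.univ.filter fun x => p (ω x)).card :=
  Finset.card_equiv σ (by simp)

lemma occNum_comp (ω : ChainCfg Ns) (σ : Perm (ZMod Ns)) : occNum (ω ∘ σ) = occNum ω :=
  card_filter_comp_perm ω σ (· ≠ none)

lemma upNum_comp (ω : ChainCfg Ns) (σ : Perm (ZMod Ns)) : upNum (ω ∘ σ) = upNum ω :=
  card_filter_comp_perm ω σ (· = some true)

lemma occNum_allUp (ω : ChainCfg Ns) : occNum (allUp ω) = occNum ω := by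
  simp [occNum]

lemma upNum_allUp (ω : ChainCfg Ns) : upNum (allUp ω) = occNum ω := by
  simp only [upNum, occNum, allUp]
  congr 1
  ext x
  cases h : ω x <;> simp [h]

lemma upNum_le_occNum (ω : ChainCfg Ns) : upNum ω ≤ occNum ω :=
  Finset.card_le_card fun x => by simp +contextual

lemma exists_occNum_eq_upNum_eq {m n : ℕ} (hn : n ≤ m) (hm : m ≤ Ns) :
    ∃ ω : ChainCfg Ns, occNum ω = m ∧ upNum ω = n := by
  obtain ⟨s, -, hs⟩ := Finset.exists_subset_card_eq (s := (Finset.univ : Finset (ZMod Ns)))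
    (n := m) (by simpa [ZMod.card] using hm)
  obtain ⟨u, hus, hu⟩ := Finset.exists_subset_card_eq (s := s) (n := n) (by omega)
  refine ⟨fun x => if x ∈ u then some true else if x ∈ s then some false else none, ?_, ?_⟩
  · rw [← hs, occNum]
    congr 1
    ext x
    have := @hus x
    by_cases h1 : x ∈ u <;> by_cases h2 : x ∈ s <;> simp_all
  · rw [← hu, upNum]
    congr 1
    ext x
    by_cases h1 : x ∈ u <;> by_cases h2 : x ∈ s <;> simp_all

lemma card_filter_eq_some_false (ω : ChainCfg Ns) :
    (Finset.univ.filter fun x => ω x = some false).card = occNum ω - upNum ω := by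
  have h : occNum ω = upNum ω + (Finset.univ.filter fun x => ω x = some false).card := by
    rw [occNum, upNum, ← Finset.card_union_of_disjoint]
    · congr 1
      ext x
      rcases h : ω x with _ | _ | _ <;> simp [h]
    · rw [Finset.disjoint_filter]
      simp +contextual
  omega

lemma card_filter_eq_none (ω : ChainCfg Ns) :
    (Finset.univ.filter fun x => ω x = none).card = Ns - occNum ω := by
  have h := Finset.card_filter_add_card_filter_not (s := (Finset.univ : Finset (ZMod Ns)))
    (fun x => ω x = none)
  rw [Finset.card_univ, ZMod.card] at h
  simp only [occNum, ne_eq]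
  omega

/-- Configurations with the same particle numbers differ by a permutation of the sites. -/
lemma exists_perm_comp_eq {ω ω' : ChainCfg Ns} (h : occNum ω = occNum ω')
    (h' : upNum ω = upNum ω') : ∃ σ : Perm (ZMod Ns), ω' = ω ∘ σ := by
  have hcard (c : Option Bool) :
      (Finset.univ.filter fun x => ω' x = c).card = (Finset.univ.filter fun x => ω x = c).card := by
    rcases c with _ | _ | _
    · rw [card_filter_eq_none, card_filter_eq_none, h]
    · rw [card_filter_eq_some_false, card_filter_eq_some_false, h, h']
    · exact h'.symm
  have e (c : Option Bool) : {x // ω' x = c} ≃ {x // ω x = c} :=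
    Fintype.equivOfCardEq (by rw [Fintype.card_subtype, Fintype.card_subtype, hcard])
  exact ⟨Equiv.ofFiberEquiv e, funext fun x => (Equiv.ofFiberEquiv_map e x).symm⟩

/-- Configurations joined by a chain of hops. -/
def HopConn : ChainCfg Ns → ChainCfg Ns → Prop :=
  Relation.EqvGen fun ω ω' => NNHop ω ω' ∨ CorrelatedHop ω ω'

/-- Permuting the sites by `σ` is a chain of hops whenever the site `h` is empty. -/
def HoleMove (h : ZMod Ns) (σ : Perm (ZMod Ns)) : Prop :=
  ∀ ω : ChainCfg Ns, ω h = none → HopConn ω (ω ∘ σ)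

lemma HoleMove.mul {h h' : ZMod Ns} {σ τ : Perm (ZMod Ns)} (hσ : HoleMove h σ)
    (hτ : HoleMove h' τ) (hh : σ h' = h) : HoleMove h (σ * τ) := fun ω hω =>
  (hσ ω hω).trans _ _ _ (hτ (ω ∘ σ) (by simpa [hh] using hω))

lemma holeMove_swap_of_nnAdj {x y : ZMod Ns} (hxy : NNAdj x y) : HoleMove y (swap x y) := by
  intro ω hω
  by_cases hx : ω x = none
  · rw [Equiv.comp_swap_eq_update, hx, hω]
    rw [show Function.update ω y none = ω by rw [← hω, Function.update_eq_self],
      show Function.update ω x none = ω by rw [← hx, Function.update_eq_self]]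
    exact .refl _
  · exact .rel _ _ (Or.inl (nnHop_iff.mpr ⟨x, y, hxy, hx, hω, rfl⟩))

lemma holeMove_swap_add_one (x : ZMod Ns) : HoleMove (x + 1) (swap x (x + 1)) :=
  holeMove_swap_of_nnAdj (Or.inl rfl)

lemma holeMove_swap_add_one' (x : ZMod Ns) : HoleMove x (swap x (x + 1)) := by
  rw [swap_comm]
  exact holeMove_swap_of_nnAdj (Or.inr rfl)

lemma holeMove_swap_zero_two (hNs : 4 ≤ Ns) : HoleMove (0 : ZMod Ns) (swap 0 2) := by
  obtain ⟨h01, h21, h02⟩ := zmod_zero_one_two_distinct hNs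
  intro ω hω
  by_cases h2 : ω 2 = none
  · rw [Equiv.comp_swap_eq_update, h2, hω]
    rw [show Function.update ω 2 none = ω by rw [← h2, Function.update_eq_self],
      show Function.update ω 0 none = ω by rw [← hω, Function.update_eq_self]]
    exact .refl _
  by_cases h1 : ω 1 = none
  · have e1 := holeMove_swap_add_one' (1 : ZMod Ns) ω h1
    rw [one_add_one_eq_two] at e1
    have e2 := holeMove_swap_add_one' (0 : ZMod Ns) (ω ∘ swap 1 2)
      (by simp [swap_apply_of_ne_of_ne h01 h02, hω])
    rw [zero_add] at e2
    refine (e1.trans _ _ _ e2).trans _ _ _ ?_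
    have : (ω ∘ swap 1 2) ∘ swap 0 1 = ω ∘ swap 0 2 := by
      funext x
      simp only [Function.comp_apply]
      by_cases hx0 : x = 0
      · subst hx0; simp
      by_cases hx1 : x = 1
      · subst hx1; simp [swap_apply_of_ne_of_ne h01 h02, swap_apply_of_ne_of_ne h01.symm h21.symm,
          hω, h1]
      by_cases hx2 : x = 2
      · subst hx2; simp [swap_apply_of_ne_of_ne h02.symm h21, hω, h1]
      · rw [swap_apply_of_ne_of_ne hx0 hx1, swap_apply_of_ne_of_ne hx1 hx2,
          swap_apply_of_ne_of_ne hx0 hx2]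
    rw [this]
    exact .refl _
  · refine .rel _ _ (Or.inr (correlatedHop_iff.mpr ⟨2, 0, ?_, h2, hω, by rw [swap_comm]⟩))
    exact ⟨0, by simp, by simpa using h1, Or.inr ⟨by simp, rfl⟩⟩

lemma holeMove_swap_one_two (hNs : 4 ≤ Ns) : HoleMove (0 : ZMod Ns) (swap 1 2) := by
  obtain ⟨h01, h21, h02⟩ := zmod_zero_one_two_distinct hNs
  have e1 : HoleMove (2 : ZMod Ns) (swap 1 2) := by
    simpa [one_add_one_eq_two] using holeMove_swap_add_one (1 : ZMod Ns)
  have e2 : HoleMove (1 : ZMod Ns) (swap 0 1) := by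
    simpa using holeMove_swap_add_one (0 : ZMod Ns)
  have h := (holeMove_swap_zero_two hNs).mul (e1.mul e2 (by simp)) (by simp)
  convert h using 1
  ext x
  by_cases hx0 : x = 0
  · subst hx0; simp [swap_apply_of_ne_of_ne h01 h02]
  by_cases hx1 : x = 1
  · subst hx1; simp [swap_apply_of_ne_of_ne h01 h02]
  by_cases hx2 : x = 2
  · subst hx2; simp [swap_apply_of_ne_of_ne h02.symm h21, swap_apply_of_ne_of_ne h01.symm h21.symm]
  · simp [swap_apply_of_ne_of_ne hx0 hx1, swap_apply_of_ne_of_ne hx1 hx2,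
      swap_apply_of_ne_of_ne hx0 hx2]

/-- Moving the hole around the whole ring translates the configuration by one site. -/
lemma holeMove_addRight_one (h : ZMod Ns) : HoleMove h (Equiv.addRight 1) := by
  intro ω hω
  have key : ∀ k : ℕ, k < Ns → HopConn ω fun x =>
      if (x - h).val < k then ω (x + 1) else if x = h + k then none else ω x := by
    intro k
    induction k with
    | zero =>
      intro _
      have : (fun x => if (x - h).val < 0 then ω (x + 1) else
          if x = h + (0 : ℕ) then none else ω x) = ω := by
        funext x
        by_cases hx : x = h <;> simp [hx, hω]
      rw [this]
      exact .refl _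
    | succ k ih =>
      intro hk
      have hstep := holeMove_swap_add_one' (h + k : ZMod Ns)
        (fun x => if (x - h).val < k then ω (x + 1) else if x = h + k then none else ω x)
        (by simp [ZMod.val_cast_of_lt (show k < Ns by omega)])
      refine Eq.mp (congrArg (HopConn ω) ?_) ((ih (by omega)).trans _ _ _ hstep)
      symm
      funext x
      have hval : ((k : ZMod Ns)).val = k := ZMod.val_cast_of_lt (by omega)
      have hval' : ((k + 1 : ZMod Ns)).val = k + 1 := by
        have := ZMod.val_cast_of_lt hk
        push_cast at this
        exact this
      have hne : (1 : ZMod Ns) ≠ 0 := by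
        intro h10
        rw [h10, add_zero] at hval'
        omega
      by_cases hx : x = h + k
      · subst hx
        simp [hval, hval', hne, add_assoc, show ¬(k + 1 < k) by omega]
      by_cases hx' : x = h + k + 1
      · subst hx'
        simp [hval, hval', add_assoc]
      · have hxk : (x - h).val ≠ k := by
          intro hv
          apply hx
          rw [← hv, ZMod.natCast_zmod_val]
          ring
        simp only [Function.comp_apply, swap_apply_of_ne_of_ne hx hx', if_neg hx, Nat.cast_add,
          Nat.cast_one, ← add_assoc, if_neg hx']
        by_cases hlt : (x - h).val < k
        · rw [if_pos hlt, if_pos (by omega)]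
        · rw [if_neg hlt, if_neg (by omega)]
  have hN : 0 < Ns := Nat.pos_of_neZero Ns
  convert key (Ns - 1) (by omega) using 1
  funext x
  have hlt := ZMod.val_lt (x - h)
  simp only [Function.comp_apply, Equiv.coe_addRight]
  split_ifs with h1 h2
  · rfl
  · have : x + 1 = h := by
      rw [h2, add_assoc]
      have : ((Ns - 1 : ℕ) : ZMod Ns) + 1 = ((Ns - 1 + 1 : ℕ) : ZMod Ns) := by push_cast; rfl
      rw [this, Nat.sub_add_cancel hN, ZMod.natCast_self, add_zero]
    rw [this, hω]
  · exfalso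
    apply h2
    rw [show Ns - 1 = (x - h).val by omega, ZMod.natCast_zmod_val]
    ring

/-- The permutations of the sites that are realized by chains of hops on every
configuration having an empty site. -/
def hopSubgroup (Ns : ℕ) [NeZero Ns] : Subgroup (Perm (ZMod Ns)) where
  carrier := {σ | ∀ h, HoleMove h σ}
  mul_mem' {σ τ} hσ hτ h := (hσ h).mul (hτ (σ⁻¹ h)) (by simp)
  one_mem' h ω _ := .refl _
  inv_mem' {σ} hσ h ω hω := by
    have := hσ (σ h) (ω ∘ ⇑σ⁻¹) (by simpa using hω)
    rw [Function.comp_assoc, ← Equiv.Perm.coe_mul, inv_mul_cancel] at this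
    exact this.symm

lemma addRight_one_mem_hopSubgroup : Equiv.addRight (1 : ZMod Ns) ∈ hopSubgroup Ns :=
  holeMove_addRight_one

lemma addRight_mem_hopSubgroup (h : ZMod Ns) : Equiv.addRight h ∈ hopSubgroup Ns := by
  have : Equiv.addRight h = Equiv.addRight (1 : ZMod Ns) ^ h.val := by
    ext x
    simp
  rw [this]
  exact pow_mem addRight_one_mem_hopSubgroup _

lemma holeMove_swap_add_one_add_two (hNs : 4 ≤ Ns) (h : ZMod Ns) :
    HoleMove h (swap (h + 1) (h + 2)) := by
  obtain ⟨h01, -, h02⟩ := zmod_zero_one_two_distinct hNs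
  have h1 := ((addRight_mem_hopSubgroup h h).mul (holeMove_swap_one_two hNs) (by simp)).mul
    (inv_mem (addRight_mem_hopSubgroup h) 0) (by simp [swap_apply_of_ne_of_ne h01 h02])
  rw [← Equiv.swap_apply_apply] at h1
  simpa [add_comm] using h1

/-- Adjacent occupied sites at any distance from the hole may be exchanged. -/
lemma holeMove_swap_add_add_one (hNs : 4 ≤ Ns) (d : ℕ) :
    ∀ h : ZMod Ns, d + 2 < Ns → HoleMove h (swap (h + (d + 1)) (h + (d + 2))) := by
  induction d with
  | zero =>
    intro h _
    simpa using holeMove_swap_add_one_add_two hNs h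
  | succ d ih =>
    intro h hd
    have hne {a b : ℕ} (hab : a < b) (hb : b < Ns) : h + (b : ZMod Ns) ≠ h + a := by
      intro he
      have := congrArg ZMod.val (add_left_cancel he)
      rw [ZMod.val_cast_of_lt hb, ZMod.val_cast_of_lt (by omega)] at this
      omega
    have h1 := hne (a := 0) (b := d + 2) (by omega) (by omega)
    have h2 := hne (a := 1) (b := d + 2) (by omega) (by omega)
    have h3 := hne (a := 0) (b := d + 3) (by omega) (by omega)
    have h4 := hne (a := 1) (b := d + 3) (by omega) (by omega)
    have h5 := hne (a := 0) (b := 1) (by omega) (by omega)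
    push_cast at h1 h2 h3 h4 h5 ⊢
    rw [add_zero] at h1 h3 h5
    have e := ih (h + 1) (by omega)
    rw [show h + 1 + ((d : ZMod Ns) + 1) = h + (d + 2) by ring,
      show h + 1 + ((d : ZMod Ns) + 2) = h + (d + 3) by ring] at e
    have e' := ((holeMove_swap_add_one' h).mul e (swap_apply_right _ _)).mul
      (holeMove_swap_add_one h) (by
        simp [swap_apply_of_ne_of_ne h2.symm h4.symm])
    have hconj := Equiv.swap_apply_apply (swap h (h + 1)) (h + ((d : ZMod Ns) + 2))
      (h + (d + 3))
    rw [Equiv.swap_inv] at hconj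
    rw [← hconj, swap_apply_of_ne_of_ne h1 h2, swap_apply_of_ne_of_ne h3 h4] at e'
    convert e' using 2 <;> ring

lemma swap_zero_one_mem_hopSubgroup (hNs : 4 ≤ Ns) : swap (0 : ZMod Ns) 1 ∈ hopSubgroup Ns := by
  intro h
  by_cases h0 : h = 0
  · subst h0
    simpa using holeMove_swap_add_one' (0 : ZMod Ns)
  by_cases h1 : h = 1
  · subst h1
    simpa using holeMove_swap_add_one (0 : ZMod Ns)
  have hd : ((-h - 1).val : ZMod Ns) = -h - 1 := ZMod.natCast_zmod_val _
  have hlt : (-h - 1).val + 2 < Ns := by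
    have hlt := ZMod.val_lt (-h - 1)
    by_contra hcon
    have : (-h - 1).val + 1 = Ns ∨ (-h - 1).val + 2 = Ns := by omega
    rcases this with hv | hv
    · have := congrArg (Nat.cast : ℕ → ZMod Ns) hv
      push_cast at this
      rw [hd, ZMod.natCast_self] at this
      exact h0 (by linear_combination -this)
    · have := congrArg (Nat.cast : ℕ → ZMod Ns) hv
      push_cast at this
      rw [hd, ZMod.natCast_self] at this
      exact h1 (by linear_combination -this)
  have := holeMove_swap_add_add_one hNs _ h hlt
  rw [hd] at this
  convert this using 2 <;> ring

lemma hopSubgroup_eq_top (hNs : 4 ≤ Ns) : hopSubgroup Ns = ⊤ := by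
  obtain ⟨h01, -, -⟩ := zmod_zero_one_two_distinct hNs
  have hcyc : (Equiv.addRight (1 : ZMod Ns)).IsCycle := by
    refine ⟨0, by simpa using h01.symm, fun y _ => ⟨y.val, ?_⟩⟩
    simp
  have hsupp : (Equiv.addRight (1 : ZMod Ns)).support = Finset.univ := by
    ext x
    simpa using h01.symm
  rw [eq_top_iff, ← Equiv.Perm.closure_cycle_adjacent_swap hcyc hsupp 0, Subgroup.closure_le]
  rintro σ (rfl | rfl)
  · exact addRight_one_mem_hopSubgroup
  · simpa using swap_zero_one_mem_hopSubgroup hNs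

/-- If there is at least one hole, the hops connect any two configurations with the same
number of particles and the same magnetization. -/
lemma hopConn_of_occNum_eq_of_upNum_eq (hNs : 4 ≤ Ns) {ω ω' : ChainCfg Ns}
    (hlt : occNum ω < Ns) (h : occNum ω = occNum ω') (h' : upNum ω = upNum ω') :
    HopConn ω ω' := by
  obtain ⟨σ, rfl⟩ := exists_perm_comp_eq h h'
  have hhole : 0 < (Finset.univ.filter fun x => ω x = none).card := by
    rw [card_filter_eq_none]
    omega
  obtain ⟨x, hx⟩ := Finset.card_pos.mp hhole
  have hσ : σ ∈ hopSubgroup Ns := hopSubgroup_eq_top hNs ▸ Subgroup.mem_top σ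
  exact hσ x ω (Finset.mem_filter.mp hx).2

end Chain

section Hamiltonian

open Equiv Matrix

variable {Ns Ne : ℕ} [NeZero Ns] {t t' : ℝ}

open Classical in
/-- The amplitude of a hop from `x` to `y` in the configuration `ω`. -/
noncomputable def hopAmp (t t' : ℝ) (ω : ChainCfg Ns) (x y : ZMod Ns) : ℝ :=
  if NNAdj x y then -t else if CorrAdj ω x y then -t' else 0

/-- The pairs consisting of an occupied site and an empty one. -/
def hopPairs (ω : ChainCfg Ns) : Finset (ZMod Ns × ZMod Ns) :=
  Finset.univ.filter fun p => ω p.1 ≠ none ∧ ω p.2 = none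

lemma CorrelatedHop.symm (hNs : 4 ≤ Ns) {ω ω' : ChainCfg Ns} (h : CorrelatedHop ω ω') :
    CorrelatedHop ω' ω := by
  obtain ⟨h01, h21, -⟩ := zmod_zero_one_two_distinct hNs
  obtain ⟨x, y, ⟨z, hz, hm, hxy⟩, hx, hy, rfl⟩ := correlatedHop_iff.mp h
  refine correlatedHop_iff.mpr ⟨y, x, corrAdj_symm ⟨z, hz, ?_, hxy⟩, by simpa using hx,
    by simpa using hy, ?_⟩
  · have h1 : z + 1 ≠ z := by simpa using h01.symm
    have h2 : z + 1 ≠ z + 2 := by simpa using h21.symm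
    rcases hxy with ⟨rfl, rfl⟩ | ⟨rfl, rfl⟩
    · simpa [swap_apply_of_ne_of_ne h1 h2] using hm
    · simpa [swap_apply_of_ne_of_ne h2 h1] using hm
  · rw [Function.comp_assoc, swap_comm y x, ← Equiv.Perm.coe_mul, Equiv.swap_mul_self]
    rfl

lemma corrHopHam_transpose (hNs : 4 ≤ Ns) : (corrHopHam Ns Ne t t')ᵀ = corrHopHam Ns Ne t t' := by
  ext ω ω'
  classical
  exact if_congr ⟨.symm, .symm⟩ rfl (if_congr ⟨.symm hNs, .symm hNs⟩ rfl rfl)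

lemma corrHopHam_nonpos (ht : 0 < t) (ht' : 0 < t') (ω ω' : HardCoreCfg Ns Ne) :
    corrHopHam Ns Ne t t' ω ω' ≤ 0 := by
  unfold corrHopHam
  split_ifs <;> linarith

lemma corrHopHam_ne_zero_iff (ht : 0 < t) (ht' : 0 < t') {ω ω' : HardCoreCfg Ns Ne} :
    corrHopHam Ns Ne t t' ω' ω ≠ 0 ↔ NNHop ω.1 ω'.1 ∨ CorrelatedHop ω.1 ω'.1 := by
  unfold corrHopHam
  split_ifs with h1 h2 <;> simp [*, ht.ne', ht'.ne']

lemma exists_comp_swap_of_hop {ω ω' : ChainCfg Ns} (h : NNHop ω ω' ∨ CorrelatedHop ω ω') :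
    ∃ x y, ω x ≠ none ∧ ω y = none ∧ ω' = ω ∘ swap x y := by
  rcases h with h | h
  · obtain ⟨x, y, -, h⟩ := nnHop_iff.mp h
    exact ⟨x, y, h⟩
  · obtain ⟨x, y, -, h⟩ := correlatedHop_iff.mp h
    exact ⟨x, y, h⟩

lemma upNum_eq_of_hop {ω ω' : ChainCfg Ns} (h : NNHop ω ω' ∨ CorrelatedHop ω ω') :
    upNum ω' = upNum ω := by
  obtain ⟨x, y, -, -, rfl⟩ := exists_comp_swap_of_hop h
  exact upNum_comp ω _

lemma occNum_eq_of_hop {ω ω' : ChainCfg Ns} (h : NNHop ω ω' ∨ CorrelatedHop ω ω') :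
    occNum ω' = occNum ω := by
  obtain ⟨x, y, -, -, rfl⟩ := exists_comp_swap_of_hop h
  exact occNum_comp ω _

lemma correlatedHop_comp_swap_iff {ω : ChainCfg Ns} {x y : ZMod Ns} (hx : ω x ≠ none)
    (hy : ω y = none) : CorrelatedHop ω (ω ∘ swap x y) ↔ CorrAdj ω x y := by
  rw [correlatedHop_iff]
  constructor
  · rintro ⟨x', y', h, hx', hy', he⟩
    obtain ⟨rfl, rfl⟩ := eq_of_comp_swap_eq_none_iff hx hy hx' hy' he
    exact h
  · exact fun h => ⟨x, y, h, hx, hy, rfl⟩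

/-- The action of the Hamiltonian as a sum over hops. -/
lemma sum_corrHopHam_mul (ω : HardCoreCfg Ns Ne) (F : ChainCfg Ns → ℝ) :
    ∑ ω', corrHopHam Ns Ne t t' ω' ω * F ω'.1
      = ∑ p ∈ hopPairs ω.1, hopAmp t t' ω.1 p.1 p.2 * F (ω.1 ∘ swap p.1 p.2) := by
  symm
  refine Finset.sum_of_injOn
    (fun p => ⟨ω.1 ∘ swap p.1 p.2, (occNum_comp ω.1 _).trans ω.2⟩) ?_ ?_ ?_ ?_
  · rintro ⟨x, y⟩ hp ⟨x', y'⟩ hp' he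
    simp only [hopPairs, Finset.coe_filter, Finset.mem_univ, true_and, Set.mem_ofPred_eq] at hp hp'
    obtain ⟨rfl, rfl⟩ :=
      eq_of_comp_swap_eq_none_iff hp.1 hp.2 hp'.1 hp'.2 (congrArg Subtype.val he)
    rfl
  · exact fun _ _ => Finset.mem_coe.mpr (Finset.mem_univ _)
  · intro ω' _ hω'
    have : ¬(NNHop ω.1 ω'.1 ∨ CorrelatedHop ω.1 ω'.1) := by
      intro h
      obtain ⟨x, y, hx, hy, he⟩ := exists_comp_swap_of_hop h
      exact hω' ⟨(x, y), by simp [hopPairs, hx, hy], Subtype.ext he.symm⟩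
    rw [not_or] at this
    simp [corrHopHam, this]
  · rintro ⟨x, y⟩ hp
    simp only [hopPairs, Finset.mem_filter, Finset.mem_univ, true_and] at hp
    classical
    exact congrArg (· * _) (if_congr (nnHop_comp_swap_iff hp.1 hp.2).symm rfl
      (if_congr (correlatedHop_comp_swap_iff hp.1 hp.2).symm rfl rfl))

/-- The Hamiltonian acts on spin-independent functions as it does on the fully polarized
sector. -/
lemma sum_corrHopHam_mul_allUp (ω ω₀ : HardCoreCfg Ns Ne) (hω : ω₀.1 = allUp ω.1)
    (F : ChainCfg Ns → ℝ) :
    ∑ ω', corrHopHam Ns Ne t t' ω' ω * F (allUp ω'.1)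
      = ∑ ω', corrHopHam Ns Ne t t' ω' ω₀ * F ω'.1 := by
  rw [sum_corrHopHam_mul ω fun ω' => F (allUp ω'), sum_corrHopHam_mul, hω]
  refine Finset.sum_congr (by simp [hopPairs]) fun p _ => ?_
  rw [allUp_comp]
  classical
  exact congrArg (· * _) (if_congr Iff.rfl rfl (if_congr corrAdj_allUp.symm rfl rfl))

/-- A function invariant under the hops is constant on each magnetization sector. -/
lemma eq_of_hop_invariant (hNs : 4 ≤ Ns) (hNe : Ne < Ns) {β : Type*}
    (f : HardCoreCfg Ns Ne → β)
    (hf : ∀ ω ω' : HardCoreCfg Ns Ne, NNHop ω.1 ω'.1 ∨ CorrelatedHop ω.1 ω'.1 → f ω = f ω')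
    {ω ω' : HardCoreCfg Ns Ne} (h : upNum ω.1 = upNum ω'.1) : f ω = f ω' := by
  have hconn := hopConn_of_occNum_eq_of_upNum_eq hNs (by rw [ω.2]; exact hNe)
    (ω.2.trans ω'.2.symm) h
  have key : ∀ {a b : ChainCfg Ns}, HopConn a b →
      occNum a = occNum b ∧
        ∀ (ha : occNum a = Ne) (hb : occNum b = Ne), f ⟨a, ha⟩ = f ⟨b, hb⟩ := by
    intro a b hab
    induction hab with
    | rel a b hab => exact ⟨(occNum_eq_of_hop hab).symm, fun ha hb => hf _ _ hab⟩
    | refl => exact ⟨rfl, fun _ _ => rfl⟩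
    | symm a b _ ih => exact ⟨ih.1.symm, fun ha hb => (ih.2 hb ha).symm⟩
    | trans a b c _ _ ih1 ih2 =>
      exact ⟨ih1.1.trans ih2.1, fun ha hc =>
        (ih1.2 ha (ih1.1.symm.trans ha)).trans (ih2.2 (ih1.1.symm.trans ha) hc)⟩
  exact (key hconn).2 ω.2 ω'.2

/-- The Hamiltonian has a strictly positive, spin-independent eigenvector. -/
lemma exists_pos_eigenvector_corrHopHam (hNs : 4 ≤ Ns) (hNe : Ne < Ns) (ht : 0 < t)
    (ht' : 0 < t') :
    ∃ (E : ℝ) (ψ : HardCoreCfg Ns Ne → ℝ), (∀ ω, 0 < ψ ω) ∧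
      corrHopHam Ns Ne t t' *ᵥ ψ = E • ψ := by
  classical
  let P := {ω : HardCoreCfg Ns Ne // upNum ω.1 = Ne}
  have hsymm := corrHopHam_transpose (Ne := Ne) (t := t) (t' := t') hNs
  have hM (ω ω' : HardCoreCfg Ns Ne) :
      corrHopHam Ns Ne t t' ω ω' = corrHopHam Ns Ne t t' ω' ω := congrFun (congrFun hsymm ω') ω
  let up (ω : HardCoreCfg Ns Ne) : P :=
    ⟨⟨allUp ω.1, (occNum_allUp ω.1).trans ω.2⟩, (upNum_allUp ω.1).trans ω.2⟩
  have hne : Nonempty P := by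
    obtain ⟨ω, h1, h2⟩ := exists_occNum_eq_upNum_eq (Ns := Ns) le_rfl hNe.le
    exact ⟨⟨⟨ω, h1⟩, h2⟩⟩
  obtain ⟨E, φ, hφ, hE⟩ := exists_pos_eigenvector
    (A := (corrHopHam Ns Ne t t').submatrix (Subtype.val : P → _) Subtype.val)
    (by rw [transpose_submatrix, hsymm]) (fun _ _ => corrHopHam_nonpos ht ht' _ _) (by
      rintro p hp ⟨i, hi⟩ j
      have := eq_of_hop_invariant hNs hNe
        (fun ω => if h : upNum ω.1 = Ne then p ⟨ω, h⟩ else True) (fun ω ω' hω => by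
          have hup := upNum_eq_of_hop hω
          by_cases h : upNum ω.1 = Ne
          · have h' := hup.trans h
            simp only [h, h', dif_pos]
            have hz := (corrHopHam_ne_zero_iff ht ht').mpr hω
            exact propext ⟨fun q => hp _ _ q (by rw [submatrix_apply, hM]; exact hz),
              fun q => hp _ _ q hz⟩
          · have h' : ¬upNum ω'.1 = Ne := hup ▸ h
            simp only [h, h', dif_neg, not_false_eq_true])
        (ω := i.1) (ω' := j.1) (i.2.trans j.2.symm)
      simp only [i.2, j.2, dif_pos] at this
      exact this ▸ hi)
  refine ⟨E, fun ω => φ (up ω), fun ω => hφ _, funext fun ω => ?_⟩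
  let F : ChainCfg Ns → ℝ := fun a =>
    if h : occNum a = Ne ∧ upNum a = Ne then φ ⟨⟨a, h.1⟩, h.2⟩ else 0
  have hF (ω' : P) : F ω'.1.1 = φ ω' := by simp [F, ω'.1.2, ω'.2]
  have hFup (ω' : HardCoreCfg Ns Ne) : F (allUp ω'.1) = φ (up ω') := hF (up ω')
  calc ∑ ω', corrHopHam Ns Ne t t' ω ω' * φ (up ω')
      = ∑ ω', corrHopHam Ns Ne t t' ω' ω * F (allUp ω'.1) :=
        Finset.sum_congr rfl fun ω' _ => by rw [hM, hFup]
    _ = ∑ ω', corrHopHam Ns Ne t t' ω' (up ω).1 * F ω'.1 :=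
        sum_corrHopHam_mul_allUp ω (up ω).1 rfl F
    _ = ∑ ω' : P, corrHopHam Ns Ne t t' ω'.1 (up ω).1 * F ω'.1.1 := by
        rw [← Finset.sum_subtype (Finset.univ.filter fun ω' => upNum ω'.1 = Ne) (by simp)
          fun ω' => corrHopHam Ns Ne t t' ω' (up ω).1 * F ω'.1]
        refine (Finset.sum_subset (Finset.filter_subset _ _) fun ω' _ h => ?_).symm
        have : upNum ω'.1 ≠ Ne := by simpa using h
        simp [F, this]
    _ = ∑ ω' : P, corrHopHam Ns Ne t t' (up ω).1 ω'.1 * φ ω' :=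
        Finset.sum_congr rfl fun ω' _ => by rw [hM, hF]
    _ = E * φ (up ω) := by simpa [mulVec, dotProduct] using congrFun hE (up ω)

/-- The Hamiltonian preserves the magnetization. -/
lemma corrHopHam_mulVec_mul_upNum (ht : 0 < t) (ht' : 0 < t') {E : ℝ}
    {ψ : HardCoreCfg Ns Ne → ℝ} (hE : corrHopHam Ns Ne t t' *ᵥ ψ = E • ψ) (c : ℕ → ℝ) :
    corrHopHam Ns Ne t t' *ᵥ (fun ω => c (upNum ω.1) * ψ ω)
      = E • fun ω => c (upNum ω.1) * ψ ω := by
  funext ω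
  have h := congrFun hE ω
  simp only [mulVec, dotProduct, Pi.smul_apply, smul_eq_mul] at h ⊢
  rw [mul_left_comm, ← h, Finset.mul_sum]
  refine Finset.sum_congr rfl fun ω' _ => ?_
  by_cases h0 : corrHopHam Ns Ne t t' ω ω' = 0
  · simp [h0]
  · rw [upNum_eq_of_hop ((corrHopHam_ne_zero_iff ht ht').mp h0)]
    ring

end Hamiltonian

/-- **Theorem 7.2: ferromagnetism in the Hubbard chain with correlated hopping at
`U = ∞`.** For even `Ns ≥ 4`, odd `Ne < Ns` and `t, t' > 0`, there is a single value
`E` such that, for each magnetization sector `n ∈ {0, …, Ne}`, `E` is the smallest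
eigenvalue of the restriction of the Hamiltonian to the sector and this lowest
eigenvalue is simple; moreover `E` is the ground-state energy and the full
ground-state eigenspace has dimension exactly `Ne + 1`. -/
theorem correlatedHopping_ferromagnetism (Ns Ne : ℕ) [NeZero Ns] (hNs : 4 ≤ Ns)
    (hNsEven : Even Ns) (hNe1 : 1 ≤ Ne) (hNe2 : Ne < Ns) (hodd : Odd Ne)
    (t t' : ℝ) (ht : 0 < t) (ht' : 0 < t') :
    ∃ E : ℝ,
      (∀ n : ℕ, n ≤ Ne →
        ∃ Φ₀ : HardCoreCfg Ns Ne → ℝ, Φ₀ ≠ 0 ∧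
          (∀ ω, upNum ω.1 ≠ n → Φ₀ ω = 0) ∧
          (corrHopHam Ns Ne t t').mulVec Φ₀ = E • Φ₀ ∧
          IsLeast {μ : ℝ | ∃ Φ : HardCoreCfg Ns Ne → ℝ, Φ ≠ 0 ∧
            (∀ ω, upNum ω.1 ≠ n → Φ ω = 0) ∧
            (corrHopHam Ns Ne t t').mulVec Φ = μ • Φ} E ∧
          (∀ Φ : HardCoreCfg Ns Ne → ℝ, (∀ ω, upNum ω.1 ≠ n → Φ ω = 0) →
            (corrHopHam Ns Ne t t').mulVec Φ = E • Φ → ∃ c : ℝ, Φ = c • Φ₀)) ∧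
      IsLeast {μ : ℝ | ∃ Φ : HardCoreCfg Ns Ne → ℝ, Φ ≠ 0 ∧
        (corrHopHam Ns Ne t t').mulVec Φ = μ • Φ} E ∧
      Module.finrank ℝ
        (Module.End.eigenspace (corrHopHam Ns Ne t t').mulVecLin E) = Ne + 1 := by
  obtain ⟨E, ψ, hψ, hE⟩ := exists_pos_eigenvector_corrHopHam hNs hNe2 ht ht'
  have hsymm := corrHopHam_transpose (Ne := Ne) (t := t) (t' := t') hNs
  have hle {μ : ℝ} {Φ : HardCoreCfg Ns Ne → ℝ} (h0 : Φ ≠ 0)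
      (hμ : (corrHopHam Ns Ne t t').mulVec Φ = μ • Φ) : E ≤ μ :=
    le_eigenvalue_of_pos_eigenvector hsymm (corrHopHam_nonpos ht ht') hψ hE hμ h0
  have hsector {Φ : HardCoreCfg Ns Ne → ℝ} (hΦ : (corrHopHam Ns Ne t t').mulVec Φ = E • Φ)
      {ω ω' : HardCoreCfg Ns Ne} (h : upNum ω.1 = upNum ω'.1) : Φ ω / ψ ω = Φ ω' / ψ ω' :=
    eq_of_hop_invariant hNs hNe2 (fun ω => Φ ω / ψ ω) (fun ω ω' hω =>
      (div_eq_div_of_pos_eigenvector hsymm (corrHopHam_nonpos ht ht') hψ hE hΦ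
        ((corrHopHam_ne_zero_iff ht ht').mpr hω)).symm) h
  have hcfg {n : ℕ} (hn : n ≤ Ne) : ∃ ω : HardCoreCfg Ns Ne, upNum ω.1 = n := by
    obtain ⟨ω, h1, h2⟩ := exists_occNum_eq_upNum_eq hn hNe2.le
    exact ⟨⟨ω, h1⟩, h2⟩
  have heig := corrHopHam_mulVec_mul_upNum ht ht' hE
  refine ⟨E, fun n hn => ?_, ⟨⟨ψ, ?_, hE⟩, ?_⟩, ?_⟩
  · obtain ⟨ω₀, hω₀⟩ := hcfg hn
    set Φ₀ : HardCoreCfg Ns Ne → ℝ := fun ω => (if upNum ω.1 = n then 1 else 0) * ψ ω with hΦ₀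
    have hne : Φ₀ ≠ 0 := fun h => (hψ ω₀).ne' (by simpa [hΦ₀, hω₀] using congrFun h ω₀)
    have hsupp (ω : HardCoreCfg Ns Ne) (hω : upNum ω.1 ≠ n) : Φ₀ ω = 0 := by simp [hΦ₀, hω]
    have hΦE : (corrHopHam Ns Ne t t').mulVec Φ₀ = E • Φ₀ := heig fun m => if m = n then 1 else 0
    refine ⟨Φ₀, hne, hsupp, hΦE, ⟨⟨Φ₀, hne, hsupp, hΦE⟩, ?_⟩, fun Φ hΦ hΦE => ?_⟩
    · rintro μ ⟨Φ, h0, -, hμ⟩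
      exact hle h0 hμ
    · refine ⟨Φ ω₀ / ψ ω₀, funext fun ω => ?_⟩
      by_cases hω : upNum ω.1 = n
      · rw [hsector hΦE (hω₀.trans hω.symm)]
        simp [hΦ₀, hω, (hψ ω).ne']
      · simp [hΦ ω hω, hsupp ω hω]
  · obtain ⟨ω₀, -⟩ := hcfg hNe1
    exact fun h => (hψ ω₀).ne' (congrFun h ω₀)
  · rintro μ ⟨Φ, h0, hμ⟩
    exact hle h0 hμ
  · have hlt (ω : HardCoreCfg Ns Ne) : upNum ω.1 < Ne + 1 :=
      Nat.lt_succ_of_le ((upNum_le_occNum ω.1).trans ω.2.le)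
    let L : (Fin (Ne + 1) → ℝ) →ₗ[ℝ] (HardCoreCfg Ns Ne → ℝ) :=
      { toFun := fun c ω => c ⟨upNum ω.1, hlt ω⟩ * ψ ω
        map_add' := fun c d => funext fun ω => add_mul _ _ _
        map_smul' := fun r c => funext fun ω => mul_assoc _ _ _ }
    have hinj : Function.Injective L := by
      intro c d hcd
      funext k
      obtain ⟨ω, hω⟩ := hcfg (Nat.le_of_lt_succ k.2)
      have h := mul_right_cancel₀ (hψ ω).ne' (congrFun hcd ω)
      simpa [hω] using h
    have hrange : LinearMap.range L
        = Module.End.eigenspace (corrHopHam Ns Ne t t').mulVecLin E := by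
      ext Φ
      rw [LinearMap.mem_range, Module.End.mem_eigenspace_iff, Matrix.mulVecLin_apply]
      constructor
      · rintro ⟨c, rfl⟩
        have hL : L c = fun ω : HardCoreCfg Ns Ne =>
            (fun m => if h : m < Ne + 1 then c ⟨m, h⟩ else 0) (upNum ω.1) * ψ ω := by
          funext ω
          simp [L, hlt ω]
        rw [hL]
        exact heig fun m => if h : m < Ne + 1 then c ⟨m, h⟩ else 0
      · intro hΦ
        choose ω hω using fun k : Fin (Ne + 1) => hcfg (Nat.le_of_lt_succ k.2)
        refine ⟨fun k => Φ (ω k) / ψ (ω k), funext fun ω' => ?_⟩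
        change Φ (ω _) / ψ (ω _) * ψ ω' = Φ ω'
        rw [hsector hΦ (hω ⟨upNum ω'.1, hlt ω'⟩), div_mul_cancel₀ _ (hψ ω').ne']
    rw [← hrange, LinearMap.finrank_range_of_inj hinj, Module.finrank_fin_fun]
end
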